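/- arXiv:2307.14350 — 2 statements merged into one kernel-verified Lean document; each statement's English description precedes it below -/
import Mathlib

section
/- Optimality of the recursive starting times (Theorem 2): if there exists some t ∈ ℝ^N satisfying the arrival constraints, deadline constraints, batch-causality constraints, and the bandwidth constraint, then the recursively defined vector t* also satisfies all four constraints; hence t* is an optimal solution of Problem (P5). -/
/-- `Ξ = max_k T^d_k + (a·K + b)`. -/
noncomputable def Xi (K : ℕ) (hK : 0 < K) (a b : ℝ) (Td : Fin K → ℝ) : ℝ :=
  Finset.univ.sup' (Finset.univ_nonempty_iff.mpr ⟨⟨0, hK⟩⟩) Td + (a * K + b)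

/-- Inference delay of a batch of `m` tasks: `d(m) = a·m + b` for `m ≥ 1`, `d(0) = 0`. -/
noncomputable def dDelay (a b : ℝ) (m : ℕ) : ℝ := if m = 0 then 0 else a * m + b

/-- Auxiliary backward recursion: `tstarAux j` is the optimal starting time `t*_{N+1-j}`
of batch `N + 1 - j` (so `tstarAux 0 = t*_{N+1} = Ξ`). -/
noncomputable def tstarAux (K : ℕ) (hK : 0 < K) (a b : ℝ) (Td : Fin K → ℝ)
    (N : ℕ) (𝒦 : ℕ → Finset (Fin K)) : ℕ → ℝ
  | 0 => Xi K hK a b Td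
  | (j + 1) =>
      if h : (𝒦 (N - j)).Nonempty then
        min ((𝒦 (N - j)).inf' h Td) (tstarAux K hK a b Td N 𝒦 j)
          - dDelay a b (𝒦 (N - j)).card
      else tstarAux K hK a b Td N 𝒦 j

/-- The recursively defined batch starting times of Theorem 2:
`t*_{N+1} = Ξ` and, for `n = N, …, 1`,
`t*_n = min(χ_n, t*_{n+1}) − d_n` if `𝒦_n ≠ ∅`, and `t*_n = t*_{n+1}` otherwise. -/
noncomputable def tstar (K : ℕ) (hK : 0 < K) (a b : ℝ) (Td : Fin K → ℝ)
    (N : ℕ) (𝒦 : ℕ → Finset (Fin K)) (n : ℕ) : ℝ :=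
  tstarAux K hK a b Td N 𝒦 (N + 1 - n)

/-- Arrival constraints: `T^a_k < t_n` for all `1 ≤ n ≤ N` and all `k ∈ 𝒦_n`. -/
def ArrivalOK (K : ℕ) (Ta : Fin K → ℝ) (N : ℕ)
    (𝒦 : ℕ → Finset (Fin K)) (t : ℕ → ℝ) : Prop :=
  ∀ n ∈ Finset.Icc 1 N, ∀ k ∈ 𝒦 n, Ta k < t n

/-- Deadline constraints: `t_n + d_n ≤ T^d_k` for all `1 ≤ n ≤ N` and all `k ∈ 𝒦_n`. -/
def DeadlineOK (K : ℕ) (a b : ℝ) (Td : Fin K → ℝ) (N : ℕ)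
    (𝒦 : ℕ → Finset (Fin K)) (t : ℕ → ℝ) : Prop :=
  ∀ n ∈ Finset.Icc 1 N, ∀ k ∈ 𝒦 n, t n + dDelay a b (𝒦 n).card ≤ Td k

/-- Batch-causality constraints: `t_n + d_n ≤ t_{n+1}` for `1 ≤ n ≤ N − 1`. -/
def CausalOK (K : ℕ) (a b : ℝ) (N : ℕ)
    (𝒦 : ℕ → Finset (Fin K)) (t : ℕ → ℝ) : Prop :=
  ∀ n, 1 ≤ n → n + 1 ≤ N → t n + dDelay a b (𝒦 n).card ≤ t (n + 1)

/-- Bandwidth constraint: `∑_{n=1}^N ∑_{k∈𝒦_n} ℓ_k/(r_k·(t_n − T^a_k)) ≤ B`. -/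
def BandwidthOK (K : ℕ) (Ta ℓ r : Fin K → ℝ) (B : ℝ) (N : ℕ)
    (𝒦 : ℕ → Finset (Fin K)) (t : ℕ → ℝ) : Prop :=
  ∑ n ∈ Finset.Icc 1 N, ∑ k ∈ 𝒦 n, ℓ k / (r k * (t n - Ta k)) ≤ B

section TStar

variable {K : ℕ} {hK : 0 < K} {a b : ℝ} {Td : Fin K → ℝ} {N : ℕ} {𝒦 : ℕ → Finset (Fin K)}

theorem le_Xi (ha : 0 ≤ a) (hb : 0 ≤ b) (k : Fin K) : Td k ≤ Xi K hK a b Td := by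
  have h : Td k ≤ Finset.univ.sup' (Finset.univ_nonempty_iff.mpr ⟨⟨0, hK⟩⟩) Td :=
    Finset.le_sup' Td (Finset.mem_univ k)
  have h' : 0 ≤ a * K + b := by positivity
  unfold Xi
  linarith

theorem tstar_last : tstar K hK a b Td N 𝒦 (N + 1) = Xi K hK a b Td := by
  simp [tstar, tstarAux]

theorem tstar_of_nonempty {n : ℕ} (hn : n ≤ N) (h : (𝒦 n).Nonempty) :
    tstar K hK a b Td N 𝒦 n =
      min ((𝒦 n).inf' h Td) (tstar K hK a b Td N 𝒦 (n + 1)) - dDelay a b (𝒦 n).card := by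
  obtain ⟨j, rfl⟩ := Nat.exists_eq_add_of_le hn
  have h₁ : n + j + 1 - n = j + 1 := by omega
  have h₂ : n + j + 1 - (n + 1) = j := by omega
  simp [tstar, tstarAux, h₁, h₂, h]

theorem tstar_of_empty {n : ℕ} (hn : n ≤ N) (h : 𝒦 n = ∅) :
    tstar K hK a b Td N 𝒦 n = tstar K hK a b Td N 𝒦 (n + 1) := by
  obtain ⟨j, rfl⟩ := Nat.exists_eq_add_of_le hn
  have h₁ : n + j + 1 - n = j + 1 := by omega
  have h₂ : n + j + 1 - (n + 1) = j := by omega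
  simp [tstar, tstarAux, h₁, h₂, h]

theorem deadlineOK_tstar : DeadlineOK K a b Td N 𝒦 (tstar K hK a b Td N 𝒦) := by
  intro n hn k hk
  rw [tstar_of_nonempty (Finset.mem_Icc.mp hn).2 ⟨k, hk⟩, sub_add_cancel]
  exact (min_le_left _ _).trans (Finset.inf'_le Td hk)

theorem causalOK_tstar : CausalOK K a b N 𝒦 (tstar K hK a b Td N 𝒦) := by
  intro n _ hn
  rcases (𝒦 n).eq_empty_or_nonempty with h | h
  · simp [tstar_of_empty (Nat.le_of_succ_le hn) h, h, dDelay]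
  · rw [tstar_of_nonempty (Nat.le_of_succ_le hn) h, sub_add_cancel]
    exact min_le_right _ _

/-- Starting times of empty batches at the end of the schedule are unconstrained, hence the
truncation at `Ξ`. -/
theorem min_Xi_le_tstar (ha : 0 ≤ a) (hb : 0 ≤ b) {t : ℕ → ℝ}
    (hdead : DeadlineOK K a b Td N 𝒦 t) (hcaus : CausalOK K a b N 𝒦 t)
    {n : ℕ} (h1 : 1 ≤ n) (hn : n ≤ N + 1) :
    min (t n) (Xi K hK a b Td) ≤ tstar K hK a b Td N 𝒦 n := by
  induction hn using Nat.decreasingInduction with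
  | self => exact tstar_last (hK := hK) ▸ min_le_right _ _
  | of_succ n hn ih =>
    have hnN : n ≤ N := by omega
    specialize ih (by omega)
    have step : min (t n + dDelay a b (𝒦 n).card) (Xi K hK a b Td) ≤
        tstar K hK a b Td N 𝒦 (n + 1) := by
      rcases hnN.eq_or_lt with rfl | hlt
      · exact tstar_last (hK := hK) ▸ min_le_right _ _
      · exact (min_le_min_right _ (hcaus n h1 hlt)).trans ih
    rcases (𝒦 n).eq_empty_or_nonempty with h | h
    · simpa [tstar_of_empty hnN h, h, dDelay] using step
    · have hd := hdead n (Finset.mem_Icc.mpr ⟨h1, hnN⟩)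
      obtain ⟨k, hk⟩ := id h
      rw [min_eq_left ((hd k hk).trans (le_Xi ha hb k))] at step
      rw [tstar_of_nonempty hnN h]
      exact (min_le_left _ _).trans
        (le_sub_iff_add_le.mpr (le_min (Finset.le_inf' h Td hd) step))

/-- `t*` dominates every schedule meeting the deadline and causality constraints, on each
nonempty batch. -/
theorem le_tstar (ha : 0 ≤ a) (hb : 0 ≤ b) {t : ℕ → ℝ}
    (hdead : DeadlineOK K a b Td N 𝒦 t) (hcaus : CausalOK K a b N 𝒦 t)
    {n : ℕ} (hn : n ∈ Finset.Icc 1 N) (h : (𝒦 n).Nonempty) :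
    t n ≤ tstar K hK a b Td N 𝒦 n := by
  obtain ⟨h1, hnN⟩ := Finset.mem_Icc.mp hn
  obtain ⟨k, hk⟩ := h
  have hdelay : 0 ≤ dDelay a b (𝒦 n).card := by
    unfold dDelay
    split_ifs <;> positivity
  have hXi : t n ≤ Xi K hK a b Td := by
    linarith [hdead n hn k hk, le_Xi (hK := hK) (Td := Td) ha hb k]
  simpa [min_eq_left hXi] using
    min_Xi_le_tstar (hK := hK) ha hb hdead hcaus h1 (Nat.le_succ_of_le hnN)

end TStar

/-- **Theorem 2.** If some starting-time vector `t` satisfies the arrival,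
deadline, batch-causality and bandwidth constraints, then the recursively defined vector
`t*` also satisfies all four constraints; hence `t*` solves Problem (P5). -/
theorem tstar_optimal (K : ℕ) (hK : 0 < K) (a b B : ℝ)
    (ha : 0 < a) (hb : 0 < b) (hB : 0 < B)
    (Ta Td ℓ r : Fin K → ℝ)
    (hTa : ∀ k, 0 ≤ Ta k) (hTaTd : ∀ k, Ta k < Td k)
    (hℓ : ∀ k, 0 < ℓ k) (hr : ∀ k, 0 < r k)
    (N : ℕ) (hN : 1 ≤ N) (𝒦 : ℕ → Finset (Fin K))
    (hdisj : ∀ m ∈ Finset.Icc 1 N, ∀ n ∈ Finset.Icc 1 N, m ≠ n → Disjoint (𝒦 m) (𝒦 n))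
    (hfeas : ∃ t : ℕ → ℝ, ArrivalOK K Ta N 𝒦 t ∧ DeadlineOK K a b Td N 𝒦 t ∧
      CausalOK K a b N 𝒦 t ∧ BandwidthOK K Ta ℓ r B N 𝒦 t) :
    ArrivalOK K Ta N 𝒦 (tstar K hK a b Td N 𝒦) ∧
    DeadlineOK K a b Td N 𝒦 (tstar K hK a b Td N 𝒦) ∧
    CausalOK K a b N 𝒦 (tstar K hK a b Td N 𝒦) ∧
    BandwidthOK K Ta ℓ r B N 𝒦 (tstar K hK a b Td N 𝒦) := by
  obtain ⟨t, harr, hdead, hcaus, hband⟩ := hfeas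
  have hle : ∀ n ∈ Finset.Icc 1 N, ∀ k ∈ 𝒦 n, t n ≤ tstar K hK a b Td N 𝒦 n :=
    fun n hn k hk => le_tstar ha.le hb.le hdead hcaus hn ⟨k, hk⟩
  refine ⟨fun n hn k hk => (harr n hn k hk).trans_le (hle n hn k hk),
    deadlineOK_tstar, causalOK_tstar, le_trans ?_ hband⟩
  refine Finset.sum_le_sum fun n hn => Finset.sum_le_sum fun k hk => ?_
  have hpos : 0 < t n - Ta k := sub_pos.mpr (harr n hn k hk)
  exact div_le_div_of_nonneg_left (hℓ k).le (mul_pos (hr k) hpos)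
    (mul_le_mul_of_nonneg_left (sub_le_sub_right (hle n hn k hk) _) (hr k).le)
end

section
/- Proposition 1 (threshold feasibility of spectrum-hole allocation): suppose Π* ∈ ℕ with Π* ≤ |F| is such that Feasible(Π*) holds and Feasible(Π) fails for every Π with Π* < Π ≤ |F| (i.e., Π* is the optimal value of Problem (P6)). Then for every Π ∈ {0, 1, …, |F|}, Feasible(Π) holds if and only if Π ≤ Π*. -/
/-- `(t, 𝒦')` is a witness for scheduling `P` additional tasks in the `(n+1)`-th batch:
`𝒦' ⊆ F` has cardinality `P`, and
(i)  `max( max_{k∈𝒦'∪S} T^a_k , t̄_n + d(m_n) ) < t`;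
(ii) `t + d(P + |S|) ≤ min( min_{k∈𝒦'∪S} T^d_k , t_{n+2} )`;
(iii) `∑_{k∈𝒦'∪S} ℓ̃_k/(r_k·(t − max(T^a_k, t̄_n))) ≤ B̄`. -/
def HoleWitness {ι : Type*} [DecidableEq ι] (F S : Finset ι)
    (Ta Td ℓ r : ι → ℝ) (tbar tnext Bbar : ℝ) (mprev : ℕ) (a b : ℝ)
    (P : ℕ) (t : ℝ) (𝒦' : Finset ι) : Prop :=
  𝒦' ⊆ F ∧ 𝒦'.card = P ∧
  (∀ k ∈ 𝒦' ∪ S, Ta k < t) ∧ tbar + dDelay a b mprev < t ∧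
  (∀ k ∈ 𝒦' ∪ S, t + dDelay a b (P + S.card) ≤ Td k) ∧
  t + dDelay a b (P + S.card) ≤ tnext ∧
  (∑ k ∈ 𝒦' ∪ S, ℓ k / (r k * (t - max (Ta k) tbar)) ≤ Bbar)

/-- `Feasible(P)`: some batch starting time `t` and set `𝒦' ⊆ F` of `P` new tasks
witness the constraints of Problem (P7). -/
def HoleFeasible {ι : Type*} [DecidableEq ι] (F S : Finset ι)
    (Ta Td ℓ r : ι → ℝ) (tbar tnext Bbar : ℝ) (mprev : ℕ) (a b : ℝ)
    (P : ℕ) : Prop :=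
  ∃ (t : ℝ) (𝒦' : Finset ι), HoleWitness F S Ta Td ℓ r tbar tnext Bbar mprev a b P t 𝒦'

theorem dDelay_nonneg {a b : ℝ} (ha : 0 ≤ a) (hb : 0 ≤ b) (m : ℕ) : 0 ≤ dDelay a b m := by
  unfold dDelay
  split_ifs <;> positivity

theorem dDelay_mono {a b : ℝ} (ha : 0 ≤ a) (hb : 0 ≤ b) : Monotone (dDelay a b) := by
  intro m n hmn
  rcases Nat.eq_zero_or_pos m with rfl | hm
  · simpa [dDelay] using dDelay_nonneg ha hb n
  · have hn : n ≠ 0 := by omega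
    simp only [dDelay, hm.ne', hn, if_false]
    gcongr

/-- Discarding new tasks from a witness keeps the starting time valid. -/
theorem HoleFeasible.of_le {ι : Type*} [DecidableEq ι] {F S : Finset ι}
    {Ta Td ℓ r : ι → ℝ} (hℓ : ∀ k ∈ F ∪ S, 0 ≤ ℓ k) (hr : ∀ k ∈ F ∪ S, 0 ≤ r k)
    {tbar tnext Bbar : ℝ} {mprev : ℕ} {a b : ℝ} (ha : 0 ≤ a) (hb : 0 ≤ b) {P Q : ℕ}
    (h : HoleFeasible F S Ta Td ℓ r tbar tnext Bbar mprev a b Q) (hPQ : P ≤ Q) :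
    HoleFeasible F S Ta Td ℓ r tbar tnext Bbar mprev a b P := by
  obtain ⟨t, K, hKF, hK, hTa, ht, hTd, htn, hsum⟩ := h
  obtain ⟨K', hK'K, hK'⟩ := Finset.exists_subset_card_eq (hPQ.trans hK.ge)
  have hsub : K' ∪ S ⊆ K ∪ S := Finset.union_subset_union_left hK'K
  have hd : dDelay a b (P + S.card) ≤ dDelay a b (Q + S.card) :=
    dDelay_mono ha hb (Nat.add_le_add_right hPQ _)
  have htbar : tbar < t := by linarith [dDelay_nonneg ha hb mprev]
  refine ⟨t, K', hK'K.trans hKF, hK', fun k hk => hTa k (hsub hk), ht,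
    fun k hk => by linarith [hTd k (hsub hk)], by linarith, ?_⟩
  refine (Finset.sum_le_sum_of_subset_of_nonneg hsub fun k hk _ => ?_).trans hsum
  have hkF : k ∈ F ∪ S := Finset.union_subset_union_left hKF hk
  exact div_nonneg (hℓ k hkF)
    (mul_nonneg (hr k hkF) (sub_nonneg.2 (max_le (hTa k hk).le htbar.le)))

/-- **Proposition 1.** Threshold feasibility of spectrum-hole allocation:
if `P* ≤ |F|` is feasible and every `P` with `P* < P ≤ |F|` is infeasible (i.e. `P*` is the
optimal value of Problem (P6)), then for every `P ≤ |F|`, `Feasible(P)` holds iff `P ≤ P*`. -/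
theorem hole_feasibility_threshold {ι : Type*} [DecidableEq ι] (F S : Finset ι)
    (hFS : Disjoint F S) (Ta Td ℓ r : ι → ℝ)
    (hℓ : ∀ k ∈ F ∪ S, 0 < ℓ k) (hr : ∀ k ∈ F ∪ S, 0 < r k)
    (tbar tnext Bbar : ℝ) (hB : 0 < Bbar) (mprev : ℕ) (a b : ℝ)
    (ha : 0 < a) (hb : 0 < b)
    (Pstar : ℕ) (hPstar : Pstar ≤ F.card)
    (hfeas : HoleFeasible F S Ta Td ℓ r tbar tnext Bbar mprev a b Pstar)
    (hinfeas : ∀ P, Pstar < P → P ≤ F.card →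
      ¬ HoleFeasible F S Ta Td ℓ r tbar tnext Bbar mprev a b P) :
    ∀ P ≤ F.card,
      (HoleFeasible F S Ta Td ℓ r tbar tnext Bbar mprev a b P ↔ P ≤ Pstar) := by
  intro P hP
  refine ⟨fun h => ?_, fun h => ?_⟩
  · by_contra hlt
    exact hinfeas P (not_le.1 hlt) hP h
  · exact hfeas.of_le (fun k hk => (hℓ k hk).le) (fun k hk => (hr k hk).le) ha.le hb.le h
end
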